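/- Convergence of JacSketch for general sketches (finitely supported case). Let W ∈ ℝ^{n×n} be symmetric positive definite and (S_j, q_j)_{j=1}^m a finitely supported sketch distribution with constants θ_j > 0 satisfying ∑_j q_j θ_j Π_{S_j} e = e. Let f_1,…,f_n : ℝ^d → ℝ be differentiable, f := (1/n)∑_i f_i, and let x* ∈ ℝ^d satisfy: ∑_i ∇f_i(x*) = 0; f(x) ≥ f(x*) for all x; and one-point strong convexity f(x*) ≥ f(x) + ⟨∇f(x), x* − x⟩ + (μ/2)‖x* − x‖² for all x, with μ > 0. Assume the expected smoothness conditions: there exist L₁, L₂ > 0 such that for all x, ∑_j q_j (θ_j/n)² ‖(∇F(x) − ∇F(x*)) Π_{S_j} e‖² ≤ 2L₁ (f(x) − f(x*)) and ∑_j q_j ‖(∇F(x) − ∇F(x*)) Π_{S_j}‖²_{W⁻¹} ≤ 2L₂ (f(x) − f(x*)). Let κ := λmin(W^{1/2}(∑_j q_j H_{S_j})W^{1/2}) and assume κ > 0; let ρ := λmax(W^{1/2}(∑_j q_j θ_j² Π_{S_j} e eᵀ Π_{S_j}ᵀ − e eᵀ)W^{1/2}). Suppose 0 < α ≤ min{1/(4L₁),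 κ/(4L₂ρ/n² + μ)}. Define, for each j, the update T_j(x, J) := (x − α g_j(x,J), J(I − Π_{S_j}) + ∇F(x)Π_{S_j}) with g_j(x,J) := (1/n)Je + (θ_j/n)(∇F(x) − J)Π_{S_j}e, and the Lyapunov function Ψ(x,J) := ‖x − x*‖² + (α/(2L₂))‖J − ∇F(x*)‖²_{W⁻¹}. Then for any initial (x⁰, J⁰) and every k ≥ 0, the expectation over i.i.d. index sequences—i.e., the sum over all (j_0,…,j_{k−1}) ∈ {1,…,m}^k with weights ∏_t q_{j_t} of Ψ evaluated at the iterates obtained by applying T_{j_0},…,T_{j_{k−1}} successively—satisfies E[Ψ(x^k, J^k)] ≤ (1 − μα)^k · Ψ(x⁰, J⁰). -/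

import Mathlib

open Matrix

/-- Weighted Frobenius norm squared: ‖X‖²_{W⁻¹} = Tr(X W⁻¹ Xᵀ). -/
noncomputable def wnorm2 {d n : ℕ} (W : Matrix (Fin n) (Fin n) ℝ)
    (X : Matrix (Fin d) (Fin n) ℝ) : ℝ :=
  Matrix.trace (X * W⁻¹ * Xᵀ)

/-- Smallest eigenvalue of a (symmetric) real matrix, as the infimum of its real spectrum. -/
noncomputable def lammin {n : ℕ} (M : Matrix (Fin n) (Fin n) ℝ) : ℝ :=
  sInf (spectrum ℝ M)

/-- Largest eigenvalue of a (symmetric) real matrix, as the supremum of its real spectrum. -/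
noncomputable def lammax {n : ℕ} (M : Matrix (Fin n) (Fin n) ℝ) : ℝ :=
  sSup (spectrum ℝ M)

/-- The (Euclidean) gradient of `f : ℝ^d → ℝ` at `x`. -/
noncomputable def grad {d : ℕ} (f : (Fin d → ℝ) → ℝ) (x : Fin d → ℝ) : Fin d → ℝ :=
  fun k => fderiv ℝ f x (Pi.single k 1)

/-- The Jacobian `∇F(x) = [∇f₁(x), …, ∇fₙ(x)] ∈ ℝ^{d×n}`. -/
noncomputable def jac {d n : ℕ} (f : Fin n → (Fin d → ℝ) → ℝ) (x : Fin d → ℝ) :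
    Matrix (Fin d) (Fin n) ℝ :=
  Matrix.of fun k i => grad (f i) x k

/-- Squared Euclidean norm. -/
def sq2 {d : ℕ} (v : Fin d → ℝ) : ℝ := ∑ k, (v k) ^ 2

/-- Euclidean inner product. -/
def inner2 {d : ℕ} (v w : Fin d → ℝ) : ℝ := ∑ k, v k * w k

/-- The all-ones vector `e ∈ ℝⁿ`. -/
def onesV (n : ℕ) : Fin n → ℝ := fun _ => 1

lemma aux_spec_finite {n : ℕ} (M : Matrix (Fin n) (Fin n) ℝ) (hM : M.IsHermitian) :
    (spectrum ℝ M).Finite := by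
  rw [hM.spectrum_real_eq_range_eigenvalues]
  exact Set.finite_range _

lemma aux_min {n : ℕ} (M : Matrix (Fin n) (Fin n) ℝ) (hM : M.IsHermitian) :
    (M - lammin M • (1 : Matrix (Fin n) (Fin n) ℝ)).PosSemidef := by
  have h1 : (M - lammin M • (1 : Matrix (Fin n) (Fin n) ℝ)).IsHermitian :=
    hM.sub (by simp [Matrix.IsHermitian])
  rw [h1.posSemidef_iff_eigenvalues_nonneg]
  intro i
  have h2 : h1.eigenvalues i ∈ spectrum ℝ (M - lammin M • (1 : Matrix (Fin n) (Fin n) ℝ)) := by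
    rw [h1.spectrum_real_eq_range_eigenvalues]; exact ⟨i, rfl⟩
  have h3 : h1.eigenvalues i + lammin M ∈ spectrum ℝ M := by
    rw [spectrum.mem_iff] at h2 ⊢
    convert h2 using 2
    rw [map_add, Algebra.algebraMap_eq_smul_one, Algebra.algebraMap_eq_smul_one]
    abel
  have h4 : lammin M ≤ h1.eigenvalues i + lammin M :=
    csInf_le (aux_spec_finite M hM).bddBelow h3
  change 0 ≤ h1.eigenvalues i
  linarith

lemma aux_max {n : ℕ} (M : Matrix (Fin n) (Fin n) ℝ) (hM : M.IsHermitian) :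
    (lammax M • (1 : Matrix (Fin n) (Fin n) ℝ) - M).PosSemidef := by
  have h1 : (lammax M • (1 : Matrix (Fin n) (Fin n) ℝ) - M).IsHermitian :=
    Matrix.IsHermitian.sub (by simp [Matrix.IsHermitian]) hM
  rw [h1.posSemidef_iff_eigenvalues_nonneg]
  intro i
  have h2 : h1.eigenvalues i ∈ spectrum ℝ (lammax M • (1 : Matrix (Fin n) (Fin n) ℝ) - M) := by
    rw [h1.spectrum_real_eq_range_eigenvalues]; exact ⟨i, rfl⟩
  have h3 : lammax M - h1.eigenvalues i ∈ spectrum ℝ M := by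
    rw [spectrum.mem_iff] at h2 ⊢
    intro h
    apply h2
    rw [← IsUnit.neg_iff]
    convert h using 1
    rw [map_sub, Algebra.algebraMap_eq_smul_one, Algebra.algebraMap_eq_smul_one]
    abel
  have h4 : lammax M - h1.eigenvalues i ≤ lammax M :=
    le_csSup (aux_spec_finite M hM).bddAbove h3
  change 0 ≤ h1.eigenvalues i
  linarith

lemma aux_trace {d n : ℕ} (P : Matrix (Fin n) (Fin n) ℝ) (hP : P.PosSemidef)
    (X : Matrix (Fin d) (Fin n) ℝ) : 0 ≤ (X * P * Xᵀ).trace := by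
  have := (hP.mul_mul_conjTranspose_same X).trace_nonneg
  rwa [conjTranspose_eq_transpose_of_trivial] at this

lemma aux_sq2 {d n : ℕ} (X : Matrix (Fin d) (Fin n) ℝ) (v : Fin n → ℝ) :
    sq2 (X *ᵥ v) = (X * vecMulVec v v * Xᵀ).trace := by
  rw [Matrix.mul_vecMulVec, Matrix.vecMulVec_mul, Matrix.vecMul_transpose, Matrix.trace_vecMulVec]
  simp [sq2, dotProduct, sq]

lemma aux_wnorm_nonneg {d n : ℕ} (W : Matrix (Fin n) (Fin n) ℝ) (hW : W.PosDef)
    (X : Matrix (Fin d) (Fin n) ℝ) : 0 ≤ wnorm2 W X :=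
  aux_trace _ hW.inv.posSemidef X

lemma aux_sq2_nonneg {d : ℕ} (v : Fin d → ℝ) : 0 ≤ sq2 v :=
  Finset.sum_nonneg fun _ _ => sq_nonneg _

/-- The trace form of `X Wh⁻¹ (Wh M Wh) Wh⁻¹ Xᵀ`. -/
lemma aux_cancel {d n : ℕ} (W Wh : Matrix (Fin n) (Fin n) ℝ)
    (hWh : Wh.PosDef) (hWh2 : Wh * Wh = W) (M : Matrix (Fin n) (Fin n) ℝ) (c : ℝ)
    (X : Matrix (Fin d) (Fin n) ℝ) :
    ((X * Wh⁻¹) * (Wh * M * Wh - c • (1 : Matrix (Fin n) (Fin n) ℝ)) * (X * Wh⁻¹)ᵀ).trace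
      = (X * M * Xᵀ).trace - c * wnorm2 W X := by
  have hu : IsUnit Wh.det := (Matrix.isUnit_iff_isUnit_det _).1 hWh.isUnit
  have hT : Whᵀ = Wh := by
    have := hWh.isHermitian
    rwa [Matrix.IsHermitian, conjTranspose_eq_transpose_of_trivial] at this
  have hWi : W⁻¹ = Wh⁻¹ * Wh⁻¹ := by rw [← hWh2, Matrix.mul_inv_rev]
  have e1 : (X * Wh⁻¹) * (Wh * M * Wh) * (X * Wh⁻¹)ᵀ = X * M * Xᵀ := by
    rw [Matrix.transpose_mul, Matrix.transpose_nonsing_inv, hT]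
    calc _ = X * (Wh⁻¹ * Wh) * M * (Wh * Wh⁻¹) * Xᵀ := by simp only [Matrix.mul_assoc]
      _ = _ := by rw [Matrix.nonsing_inv_mul _ hu, Matrix.mul_nonsing_inv _ hu]; simp
  have e2 : (X * Wh⁻¹) * (X * Wh⁻¹)ᵀ = X * W⁻¹ * Xᵀ := by
    rw [Matrix.transpose_mul, Matrix.transpose_nonsing_inv, hT, hWi]
    simp only [Matrix.mul_assoc]
  rw [Matrix.mul_sub, Matrix.sub_mul, e1, Matrix.mul_smul, Matrix.smul_mul, Matrix.mul_one, e2,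
    Matrix.trace_sub, Matrix.trace_smul, smul_eq_mul, wnorm2]

lemma aux_conj_herm {n : ℕ} (Wh M : Matrix (Fin n) (Fin n) ℝ)
    (hWh : Wh.PosDef) (hM : M.IsHermitian) : (Wh * M * Wh).IsHermitian := by
  have h := Matrix.isHermitian_mul_mul_conjTranspose Wh hM
  rwa [hWh.isHermitian.eq] at h

lemma aux_lower {d n : ℕ} (W Wh : Matrix (Fin n) (Fin n) ℝ)
    (hWh : Wh.PosDef) (hWh2 : Wh * Wh = W) (M : Matrix (Fin n) (Fin n) ℝ) (hM : M.IsHermitian)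
    (X : Matrix (Fin d) (Fin n) ℝ) :
    lammin (Wh * M * Wh) * wnorm2 W X ≤ (X * M * Xᵀ).trace := by
  have h := aux_trace _ (aux_min _ (aux_conj_herm Wh M hWh hM)) (X * Wh⁻¹)
  rw [aux_cancel W Wh hWh hWh2] at h
  linarith

lemma aux_upper {d n : ℕ} (W Wh : Matrix (Fin n) (Fin n) ℝ)
    (hWh : Wh.PosDef) (hWh2 : Wh * Wh = W) (M : Matrix (Fin n) (Fin n) ℝ) (hM : M.IsHermitian)
    (X : Matrix (Fin d) (Fin n) ℝ) :
    (X * M * Xᵀ).trace ≤ lammax (Wh * M * Wh) * wnorm2 W X := by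
  have h := aux_trace _ (aux_max _ (aux_conj_herm Wh M hWh hM)) (X * Wh⁻¹)
  rw [← neg_sub, Matrix.mul_neg, Matrix.neg_mul, Matrix.trace_neg, aux_cancel W Wh hWh hWh2] at h
  linarith

/-- Properties of the projection. -/
lemma aux_proj {n t : ℕ} (W : Matrix (Fin n) (Fin n) ℝ) (hW : W.PosDef)
    (S : Matrix (Fin n) (Fin t) ℝ) (hS : IsUnit (Sᵀ * W * S))
    (P H : Matrix (Fin n) (Fin n) ℝ) (hP : P = S * (Sᵀ * W * S)⁻¹ * Sᵀ * W)
    (hH : H = S * (Sᵀ * W * S)⁻¹ * Sᵀ) :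
    Hᵀ = H ∧ P * W⁻¹ = H ∧ W⁻¹ * Pᵀ = H ∧ P * H = H := by
  have hu : IsUnit W.det := (Matrix.isUnit_iff_isUnit_det _).1 hW.isUnit
  have hu2 : IsUnit (Sᵀ * W * S).det := (Matrix.isUnit_iff_isUnit_det _).1 hS
  have hT : Wᵀ = W := by
    have := hW.isHermitian
    rwa [Matrix.IsHermitian, conjTranspose_eq_transpose_of_trivial] at this
  have hHT : Hᵀ = H := by
    rw [hH]
    simp only [Matrix.transpose_mul, Matrix.transpose_nonsing_inv, Matrix.transpose_transpose, hT,
      Matrix.mul_assoc]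
  have hPH : P = H * W := by rw [hP, hH]
  refine ⟨hHT, ?_, ?_, ?_⟩
  · rw [hPH, Matrix.mul_assoc, Matrix.mul_nonsing_inv _ hu, Matrix.mul_one]
  · rw [hPH, Matrix.transpose_mul, hHT, hT, ← Matrix.mul_assoc, Matrix.nonsing_inv_mul _ hu,
      Matrix.one_mul]
  · rw [hP, hH]
    calc _ = S * ((Sᵀ * W * S)⁻¹ * (Sᵀ * W * S)) * (Sᵀ * W * S)⁻¹ * Sᵀ := by
          simp only [Matrix.mul_assoc]
      _ = _ := by rw [Matrix.nonsing_inv_mul _ hu2, Matrix.mul_one]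

lemma aux_wnorm_step {d n : ℕ} (W P H : Matrix (Fin n) (Fin n) ℝ)
    (h2 : P * W⁻¹ = H) (h3 : W⁻¹ * Pᵀ = H) (h4 : P * H = H)
    (X Y : Matrix (Fin d) (Fin n) ℝ) :
    wnorm2 W (X * (1 - P) + Y * P) = wnorm2 W X - (X * H * Xᵀ).trace + wnorm2 W (Y * P) := by
  have e : (X * (1 - P) + Y * P) * W⁻¹ * (X * (1 - P) + Y * P)ᵀ
      = X * W⁻¹ * Xᵀ - X * H * Xᵀ + (Y * P) * W⁻¹ * (Y * P)ᵀ := by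
    have a1 : (X * (1 - P) + Y * P) * W⁻¹ = X * W⁻¹ - X * H + Y * H := by
      rw [Matrix.add_mul, Matrix.mul_assoc, Matrix.mul_assoc, Matrix.sub_mul, h2, Matrix.one_mul,
        Matrix.mul_sub]
    have a2 : H * Pᵀ = H := by rw [← h2, Matrix.mul_assoc, h3, h4, h2]
    have a3 : (X * (1 - P) + Y * P)ᵀ = Xᵀ - Pᵀ * Xᵀ + Pᵀ * Yᵀ := by
      simp [Matrix.transpose_mul, Matrix.sub_mul]
    rw [a1, a3, Matrix.transpose_mul, Matrix.mul_assoc Y P, h2]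
    simp only [Matrix.add_mul, Matrix.mul_add, Matrix.sub_mul, Matrix.mul_sub]
    have b1 : ∀ Z : Matrix (Fin n) (Fin d) ℝ, ∀ U : Matrix (Fin d) (Fin n) ℝ,
        U * W⁻¹ * (Pᵀ * Z) = U * H * Z := by
      intro Z U
      rw [← h3]; simp only [Matrix.mul_assoc]
    have b2 : ∀ Z : Matrix (Fin n) (Fin d) ℝ, ∀ U : Matrix (Fin d) (Fin n) ℝ,
        U * H * (Pᵀ * Z) = U * H * Z := by
      intro Z U
      conv_rhs => rw [← a2]
      simp only [Matrix.mul_assoc]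
    simp only [b1, b2]
    abel
  rw [wnorm2, e, Matrix.trace_add, Matrix.trace_sub]; rfl

lemma aux_grad {d n : ℕ} (f : Fin n → (Fin d → ℝ) → ℝ) (hdiff : ∀ i, Differentiable ℝ (f i))
    (fbar : (Fin d → ℝ) → ℝ) (hfbar : ∀ x, fbar x = (1 / (n : ℝ)) * ∑ i, f i x)
    (x : Fin d → ℝ) : grad fbar x = (1 / (n : ℝ)) • (jac f x) *ᵥ (onesV n) := by
  have : fbar = fun x => (1 / (n : ℝ)) * ∑ i, f i x := funext hfbar
  subst this
  funext k
  simp only [grad]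
  have hs : HasFDerivAt (fun x => (1 / (n : ℝ)) * ∑ i, f i x)
      ((1 / (n : ℝ)) • ∑ i, fderiv ℝ (f i) x) x :=
    (HasFDerivAt.fun_sum fun i _ => (hdiff i x).hasFDerivAt).const_mul _
  rw [hs.fderiv]
  simp [mulVec, dotProduct, onesV, jac, grad]

lemma aux_sq2_expand {d : ℕ} (u v : Fin d → ℝ) (a : ℝ) :
    sq2 (u - a • v) = sq2 u - 2 * a * inner2 v u + a ^ 2 * sq2 v := by
  simp only [sq2, inner2, Finset.mul_sum, ← Finset.sum_sub_distrib, ← Finset.sum_add_distrib]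
  refine Finset.sum_congr rfl fun k _ => ?_
  simp; ring

lemma aux_sq2_add {d : ℕ} (u v : Fin d → ℝ) :
    sq2 (u + v) ≤ 2 * sq2 u + 2 * sq2 v := by
  simp only [sq2, Finset.mul_sum, ← Finset.sum_add_distrib]
  refine Finset.sum_le_sum fun k _ => ?_
  simp only [Pi.add_apply]
  nlinarith [sq_nonneg (u k - v k)]

lemma aux_inner_sum {d m : ℕ} (q : Fin m → ℝ) (v : Fin m → Fin d → ℝ) (u : Fin d → ℝ) :
    ∑ j, q j * inner2 (v j) u = inner2 (∑ j, q j • v j) u := by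
  simp only [inner2, Finset.mul_sum]
  rw [Finset.sum_comm]
  refine Finset.sum_congr rfl fun k _ => ?_
  simp [Finset.sum_mul, mul_assoc]

lemma aux_iter {σ : Type*} {m : ℕ} (q : Fin m → ℝ) (hq : ∀ j, 0 ≤ q j)
    (T : Fin m → σ → σ) (Ψ : σ → ℝ) (hΨ : ∀ s, 0 ≤ Ψ s) (c : ℝ)
    (h : ∀ s, ∑ j, q j * Ψ (T j s) ≤ c * Ψ s) (k : ℕ) : ∀ s : σ,
    ∑ js : Fin k → Fin m, (∏ t, q (js t)) * Ψ ((List.ofFn js).foldl (fun s j => T j s) s)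
      ≤ c ^ k * Ψ s := by
  rcases le_or_gt 0 c with hc | hc
  · induction k with
    | zero => intro s; simp
    | succ k ih =>
      intro s
      rw [← (Fin.consEquiv (fun _ : Fin (k + 1) => Fin m)).sum_comp, Fintype.sum_prod_type]
      simp only [Fin.consEquiv_apply, Fin.prod_univ_succ, Fin.cons_zero, Fin.cons_succ,
        List.ofFn_succ, List.foldl_cons, mul_assoc]
      simp only [← Finset.mul_sum]
      calc _ ≤ ∑ j, q j * (c ^ k * Ψ (T j s)) :=
            Finset.sum_le_sum fun j _ => mul_le_mul_of_nonneg_left (ih _) (hq j)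
        _ = c ^ k * ∑ j, q j * Ψ (T j s) := by
            rw [Finset.mul_sum]; exact Finset.sum_congr rfl fun j _ => by ring
        _ ≤ c ^ k * (c * Ψ s) := mul_le_mul_of_nonneg_left (h s) (pow_nonneg hc k)
        _ = _ := by ring
  · have h0 : ∀ s, Ψ s = 0 := by
      intro s
      have h1 : 0 ≤ ∑ j, q j * Ψ (T j s) :=
        Finset.sum_nonneg fun j _ => mul_nonneg (hq j) (hΨ _)
      have := h s
      nlinarith [hΨ s]
    intro s
    simp [h0]

/-- Convergence of JacSketch for general (finitely supported) sketches: the expected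
Lyapunov function decays as `(1 − μα)ᵏ`. -/
theorem jacsketch_convergence_general_sketches
    {d n m : ℕ} (hn : 0 < n)
    (W Wh : Matrix (Fin n) (Fin n) ℝ) (hW : W.PosDef)
    (hWh : Wh.PosDef) (hWh2 : Wh * Wh = W)
    (τs : Fin m → ℕ) (S : ∀ j, Matrix (Fin n) (Fin (τs j)) ℝ)
    (hS : ∀ j, IsUnit ((S j)ᵀ * W * S j))
    (q : Fin m → ℝ) (hq : ∀ j, 0 ≤ q j) (hq1 : ∑ j, q j = 1)
    (Pr H : Fin m → Matrix (Fin n) (Fin n) ℝ)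
    (hPr : ∀ j, Pr j = S j * ((S j)ᵀ * W * S j)⁻¹ * (S j)ᵀ * W)
    (hH : ∀ j, H j = S j * ((S j)ᵀ * W * S j)⁻¹ * (S j)ᵀ)
    (θ : Fin m → ℝ) (hθ : ∀ j, 0 < θ j)
    (hunbiased : ∑ j, (q j * θ j) • (Pr j).mulVec (onesV n) = onesV n)
    (f : Fin n → (Fin d → ℝ) → ℝ) (hdiff : ∀ i, Differentiable ℝ (f i))
    (fbar : (Fin d → ℝ) → ℝ) (hfbar : ∀ x, fbar x = (1 / (n : ℝ)) * ∑ i, f i x)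
    (xs : Fin d → ℝ) (hcrit : ∑ i, grad (f i) xs = 0)
    (hmin : ∀ x, fbar xs ≤ fbar x)
    (μ : ℝ) (hμ : 0 < μ)
    (hsc : ∀ x : Fin d → ℝ,
      fbar xs ≥ fbar x + inner2 (grad fbar x) (xs - x) + μ / 2 * sq2 (xs - x))
    (L₁ L₂ : ℝ) (hL₁pos : 0 < L₁) (hL₂pos : 0 < L₂)
    (hES1 : ∀ x : Fin d → ℝ,
      ∑ j, q j * ((θ j / n) ^ 2 * sq2 (((jac f x - jac f xs) * Pr j).mulVec (onesV n)))
        ≤ 2 * L₁ * (fbar x - fbar xs))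
    (hES2 : ∀ x : Fin d → ℝ,
      ∑ j, q j * wnorm2 W ((jac f x - jac f xs) * Pr j) ≤ 2 * L₂ * (fbar x - fbar xs))
    (κ : ℝ) (hκ : κ = lammin (Wh * (∑ j, q j • H j) * Wh)) (hκpos : 0 < κ)
    (ρ : ℝ)
    (hρ : ρ = lammax (Wh *
        ((∑ j, (q j * θ j ^ 2) •
            vecMulVec ((Pr j).mulVec (onesV n)) ((Pr j).mulVec (onesV n)))
          - vecMulVec (onesV n) (onesV n)) * Wh))
    (α : ℝ) (hα0 : 0 < α)
    (hα : α ≤ min (1 / (4 * L₁)) (κ / (4 * L₂ * ρ / (n : ℝ) ^ 2 + μ)))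
    (g : Fin m → (Fin d → ℝ) × Matrix (Fin d) (Fin n) ℝ → (Fin d → ℝ))
    (hg : ∀ (j : Fin m) (x : Fin d → ℝ) (J : Matrix (Fin d) (Fin n) ℝ),
      g j (x, J) = (1 / (n : ℝ)) • J.mulVec (onesV n)
        + (θ j / n) • ((jac f x - J) * Pr j).mulVec (onesV n))
    (T : Fin m → (Fin d → ℝ) × Matrix (Fin d) (Fin n) ℝ →
        (Fin d → ℝ) × Matrix (Fin d) (Fin n) ℝ)
    (hT : ∀ (j : Fin m) (x : Fin d → ℝ) (J : Matrix (Fin d) (Fin n) ℝ),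
      T j (x, J) = (x - α • g j (x, J), J * (1 - Pr j) + jac f x * Pr j))
    (Ψ : (Fin d → ℝ) × Matrix (Fin d) (Fin n) ℝ → ℝ)
    (hΨ : ∀ (x : Fin d → ℝ) (J : Matrix (Fin d) (Fin n) ℝ),
      Ψ (x, J) = sq2 (x - xs) + (α / (2 * L₂)) * wnorm2 W (J - jac f xs))
    (x0 : Fin d → ℝ) (J0 : Matrix (Fin d) (Fin n) ℝ) :
    ∀ k : ℕ,
      ∑ js : Fin k → Fin m, (∏ t, q (js t)) *
          Ψ ((List.ofFn js).foldl (fun s j => T j s) (x0, J0))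
        ≤ (1 - μ * α) ^ k * Ψ (x0, J0) := by
  have hnR : (0 : ℝ) < n := by exact_mod_cast hn
  set e := onesV n with he
  set Js := jac f xs with hJs
  have hJse : Js *ᵥ e = 0 := by
    funext k
    have := congrFun hcrit k
    simpa [mulVec, dotProduct, hJs, he, jac, onesV] using this
  have hpr := fun j => aux_proj W hW (S j) (hS j) (Pr j) (H j) (hPr j) (hH j)
  have hΨ0 : ∀ s, 0 ≤ Ψ s := by
    rintro ⟨x, J⟩
    rw [hΨ]
    have := aux_wnorm_nonneg W hW (J - Js)
    have := aux_sq2_nonneg (x - xs)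
    positivity
  set M := (∑ j, (q j * θ j ^ 2) • vecMulVec ((Pr j).mulVec e) ((Pr j).mulVec e))
          - vecMulVec e e with hM
  have hvv : ∀ v : Fin n → ℝ, (vecMulVec v v).IsHermitian := by
    intro v
    rw [Matrix.IsHermitian, conjTranspose_eq_transpose_of_trivial, transpose_vecMulVec]
  have hMh : M.IsHermitian := by
    rw [Matrix.IsHermitian, hM, conjTranspose_sub, conjTranspose_sum, (hvv e).eq]
    simp only [conjTranspose_smul, (hvv _).eq, star_trivial]
  have hHh : (∑ j, q j • H j).IsHermitian := by
    rw [Matrix.IsHermitian, conjTranspose_sum]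
    refine Finset.sum_congr rfl fun j _ => ?_
    rw [conjTranspose_smul, conjTranspose_eq_transpose_of_trivial, (hpr j).1, star_trivial]
  -- variance identity
  have hvar : ∀ {d' : ℕ} (X : Matrix (Fin d') (Fin n) ℝ),
      ∑ j, q j * sq2 (X *ᵥ e - θ j • X *ᵥ (Pr j *ᵥ e)) = (X * M * Xᵀ).trace := by
    intro d' X
    have e1 : (X * M * Xᵀ).trace
        = ∑ j, q j * θ j ^ 2 * sq2 (X *ᵥ (Pr j *ᵥ e)) - sq2 (X *ᵥ e) := by
      rw [hM, Matrix.mul_sub, Matrix.sub_mul, Matrix.trace_sub, ← aux_sq2, Matrix.mul_sum,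
        Matrix.sum_mul, Matrix.trace_sum]
      congr 1
      refine Finset.sum_congr rfl fun j _ => ?_
      rw [Matrix.mul_smul, Matrix.smul_mul, Matrix.trace_smul, ← aux_sq2, smul_eq_mul]
    have e2 : ∑ j, q j * θ j * inner2 (X *ᵥ (Pr j *ᵥ e)) (X *ᵥ e) = sq2 (X *ᵥ e) := by
      rw [aux_inner_sum]
      have : ∑ j, (q j * θ j) • X *ᵥ (Pr j *ᵥ e) = X *ᵥ e := by
        conv_rhs => rw [← hunbiased]
        rw [Matrix.mulVec_sum]
        exact Finset.sum_congr rfl fun j _ => (Matrix.mulVec_smul _ _ _).symm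
      rw [this]
      simp [inner2, sq2, sq]
    rw [e1]
    calc _ = ∑ j, (q j * sq2 (X *ᵥ e) - 2 * (q j * θ j * inner2 (X *ᵥ (Pr j *ᵥ e)) (X *ᵥ e))
            + q j * θ j ^ 2 * sq2 (X *ᵥ (Pr j *ᵥ e))) := by
          refine Finset.sum_congr rfl fun j _ => ?_
          rw [aux_sq2_expand]; ring
      _ = _ := by
          rw [Finset.sum_add_distrib, Finset.sum_sub_distrib, ← Finset.sum_mul, ← Finset.mul_sum,
            e2, hq1]
          ring
  have hρ0 : 0 ≤ ρ := by
    -- test with a single nonzero row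
    let X : Matrix (Fin 1) (Fin n) ℝ := Matrix.of fun _ _ => 1
    have h1 := aux_upper W Wh hWh hWh2 M hMh X
    rw [← hρ, ← hvar X] at h1
    have h2 : 0 ≤ ∑ j, q j * sq2 (X *ᵥ e - θ j • X *ᵥ (Pr j *ᵥ e)) :=
      Finset.sum_nonneg fun j _ => mul_nonneg (hq j) (aux_sq2_nonneg _)
    have h3 : 0 < wnorm2 W X := by
      have h4 := hW.inv.dotProduct_mulVec_pos (x := e) (by
        intro h
        have := congrFun h ⟨0, hn⟩
        simp [he, onesV] at this)
      have h5 : wnorm2 W X = star e ⬝ᵥ W⁻¹ *ᵥ e := by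
        rw [dotProduct_mulVec]
        simp [wnorm2, Matrix.trace, Matrix.mul_apply, X, dotProduct, he, onesV, vecMul]
      rwa [h5]
    by_contra hneg
    push Not at hneg
    nlinarith
  have hα1 : 4 * L₁ * α ≤ 1 := by
    have := hα.trans (min_le_left _ _)
    rw [le_div_iff₀ (by positivity)] at this
    linarith
  have hα2 : α * (4 * L₂ * ρ / (n : ℝ) ^ 2 + μ) ≤ κ := by
    have := hα.trans (min_le_right _ _)
    rwa [le_div_iff₀ (by positivity)] at this
  refine fun k => aux_iter q hq T Ψ hΨ0 (1 - μ * α) ?_ k (x0, J0)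
  rintro ⟨x, J⟩
  set X := J - Js with hX
  set Y := jac f x - Js with hY
  set D := fbar x - fbar xs with hD
  have hD0 : 0 ≤ D := sub_nonneg.2 (hmin x)
  have hN0 : 0 ≤ wnorm2 W X := aux_wnorm_nonneg W hW X
  -- Jacobian part
  have hJ : ∑ j, q j * wnorm2 W (J * (1 - Pr j) + jac f x * Pr j - Js)
      ≤ (1 - κ) * wnorm2 W X + 2 * L₂ * D := by
    have h1 : ∀ j, wnorm2 W (J * (1 - Pr j) + jac f x * Pr j - Js)
        = wnorm2 W X - (X * H j * Xᵀ).trace + wnorm2 W (Y * Pr j) := by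
      intro j
      rw [← aux_wnorm_step W (Pr j) (H j) (hpr j).2.1 (hpr j).2.2.1 (hpr j).2.2.2]
      congr 1
      rw [hX, hY]
      simp only [Matrix.mul_sub, Matrix.sub_mul, Matrix.mul_one]
      abel
    have h2 : ∑ j, q j * (X * H j * Xᵀ).trace = (X * (∑ j, q j • H j) * Xᵀ).trace := by
      rw [Matrix.mul_sum, Matrix.sum_mul, Matrix.trace_sum]
      refine Finset.sum_congr rfl fun j _ => ?_
      rw [Matrix.mul_smul, Matrix.smul_mul, Matrix.trace_smul, smul_eq_mul]
    have h3 := aux_lower W Wh hWh hWh2 _ hHh X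
    rw [← hκ] at h3
    have h4 := hES2 x
    simp only [h1, mul_add, mul_sub, Finset.sum_add_distrib, Finset.sum_sub_distrib,
      ← Finset.sum_mul, hq1, h2]
    linarith
  -- gradient estimator: mean
  have hgm : ∑ j, q j • g j (x, J) = grad fbar x := by
    rw [aux_grad f hdiff fbar hfbar]
    have h1 : ∀ j, q j • g j (x, J) = q j • ((1 / (n : ℝ)) • J *ᵥ e)
        + (1 / (n : ℝ)) • (jac f x - J) *ᵥ ((q j * θ j) • (Pr j *ᵥ e)) := by
      intro j
      rw [hg, smul_add, Matrix.mulVec_smul, ← Matrix.mulVec_mulVec, smul_smul, smul_smul, smul_smul]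
      congr 2
      ring
    simp only [h1]
    rw [Finset.sum_add_distrib, ← Finset.sum_smul, hq1, one_smul, ← Finset.smul_sum,
      ← Matrix.mulVec_sum, hunbiased, ← smul_add, ← Matrix.add_mulVec]
    simp [he]
  -- gradient estimator: second moment
  have hg2 : ∑ j, q j * sq2 (g j (x, J)) ≤ 4 * L₁ * D + 2 * (ρ / (n : ℝ) ^ 2) * wnorm2 W X := by
    have h1 : ∀ j, sq2 (g j (x, J)) ≤ 2 * ((θ j / n) ^ 2 * sq2 ((Y * Pr j) *ᵥ e))
        + 2 * ((1 / (n : ℝ) ^ 2) * sq2 (X *ᵥ e - θ j • X *ᵥ (Pr j *ᵥ e))) := by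
      intro j
      have hs : ∀ (a : ℝ) (v : Fin d → ℝ), sq2 (a • v) = a ^ 2 * sq2 v := by
        intro a v
        simp [sq2, Finset.mul_sum, mul_pow]
      have h2 : g j (x, J) = (θ j / n) • ((Y * Pr j) *ᵥ e)
          + (1 / (n : ℝ)) • (X *ᵥ e - θ j • X *ᵥ (Pr j *ᵥ e)) := by
        rw [hg, hX, hY]
        simp only [← Matrix.mulVec_mulVec, Matrix.sub_mulVec, hJse]
        funext k
        simp
        ring
      rw [h2]
      refine (aux_sq2_add _ _).trans (le_of_eq ?_)
      rw [hs, hs, _root_.one_div_pow]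
    have h3 := aux_upper W Wh hWh hWh2 M hMh X
    rw [← hρ, ← hvar X] at h3
    have h4 := hES1 x
    calc _ ≤ ∑ j, q j * (2 * ((θ j / n) ^ 2 * sq2 ((Y * Pr j) *ᵥ e))
        + 2 * ((1 / (n : ℝ) ^ 2) * sq2 (X *ᵥ e - θ j • X *ᵥ (Pr j *ᵥ e)))) :=
          Finset.sum_le_sum fun j _ => mul_le_mul_of_nonneg_left (h1 j) (hq j)
      _ = 2 * ∑ j, q j * ((θ j / n) ^ 2 * sq2 ((Y * Pr j) *ᵥ e))
        + 2 * (1 / (n : ℝ) ^ 2) * ∑ j, q j * sq2 (X *ᵥ e - θ j • X *ᵥ (Pr j *ᵥ e)) := by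
          rw [Finset.mul_sum, Finset.mul_sum, ← Finset.sum_add_distrib]
          exact Finset.sum_congr rfl fun j _ => by ring
      _ ≤ 2 * (2 * L₁ * D) + 2 * (1 / (n : ℝ) ^ 2) * (ρ * wnorm2 W X) := by
          gcongr
      _ = _ := by ring
  -- iterate part
  have hx : ∑ j, q j * sq2 (x - α • g j (x, J) - xs)
      ≤ (1 - μ * α) * sq2 (x - xs) - 2 * α * D
        + α ^ 2 * (4 * L₁ * D + 2 * (ρ / (n : ℝ) ^ 2) * wnorm2 W X) := by
    have h1 : ∑ j, q j * sq2 (x - α • g j (x, J) - xs)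
        = sq2 (x - xs) - 2 * α * inner2 (grad fbar x) (x - xs)
          + α ^ 2 * ∑ j, q j * sq2 (g j (x, J)) := by
      rw [← hgm, ← aux_inner_sum]
      calc _ = ∑ j, (q j * sq2 (x - xs) - 2 * α * (q j * inner2 (g j (x, J)) (x - xs))
              + α ^ 2 * (q j * sq2 (g j (x, J)))) := by
            refine Finset.sum_congr rfl fun j _ => ?_
            rw [sub_right_comm, aux_sq2_expand]; ring
        _ = _ := by
            rw [Finset.sum_add_distrib, Finset.sum_sub_distrib, ← Finset.sum_mul,
              ← Finset.mul_sum, ← Finset.mul_sum, hq1, one_mul]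
    have h2 := hsc x
    have h3 : inner2 (grad fbar x) (xs - x) = - inner2 (grad fbar x) (x - xs) := by
      simp only [inner2, ← Finset.sum_neg_distrib]
      exact Finset.sum_congr rfl fun k _ => by simp; ring
    have h4 : sq2 (xs - x) = sq2 (x - xs) := by
      simp only [sq2]
      exact Finset.sum_congr rfl fun k _ => by simp; ring
    rw [h3, h4] at h2
    rw [h1]
    have h5 : α * (D + μ / 2 * sq2 (x - xs)) ≤ α * inner2 (grad fbar x) (x - xs) :=
      mul_le_mul_of_nonneg_left (by rw [hD]; linarith) hα0.le
    have h6 := mul_le_mul_of_nonneg_left hg2 (sq_nonneg α)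
    linarith
  simp only [hT, hΨ]
  have hsum : ∑ j, q j * (sq2 (x - α • g j (x, J) - xs)
      + α / (2 * L₂) * wnorm2 W (J * (1 - Pr j) + jac f x * Pr j - Js))
      = ∑ j, q j * sq2 (x - α • g j (x, J) - xs)
        + α / (2 * L₂) * ∑ j, q j * wnorm2 W (J * (1 - Pr j) + jac f x * Pr j - Js) := by
    rw [Finset.mul_sum, ← Finset.sum_add_distrib]
    exact Finset.sum_congr rfl fun j _ => by ring
  rw [hsum]
  have hc : 0 ≤ α / (2 * L₂) := by positivity
  have hJ' := mul_le_mul_of_nonneg_left hJ hc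
  have k1 : α / (2 * L₂) * (2 * L₂ * D) = α * D := by field_simp
  have k2 : 4 * L₁ * α * (α * D) ≤ 1 * (α * D) :=
    mul_le_mul_of_nonneg_right hα1 (mul_nonneg hα0.le hD0)
  have k3 : α / (2 * L₂) * wnorm2 W X * (α * (4 * L₂ * ρ / (n : ℝ) ^ 2 + μ))
      ≤ α / (2 * L₂) * wnorm2 W X * κ :=
    mul_le_mul_of_nonneg_left hα2 (mul_nonneg hc hN0)
  have k4 : α / (2 * L₂) * wnorm2 W X * (α * (4 * L₂ * ρ / (n : ℝ) ^ 2 + μ))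
      = α ^ 2 * (2 * (ρ / (n : ℝ) ^ 2) * wnorm2 W X) + α / (2 * L₂) * wnorm2 W X * (μ * α) := by
    field_simp
    ring
  linarith
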